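/- Let W be a 2-dimensional linear family of bisectors (a line of bisectors). Then the bisectors of the family have a common slice: there is a 2-dimensional ℂ-linear subspace U ⊆ V such that ⟨h u, u'⟩ = 0 for all h ∈ W and all u, u' ∈ U; in particular the complex projective line ℙ(U) is contained in B_h for every nonzero h ∈ W. -/

import Mathlib

open scoped ComplexConjugate

noncomputable section

/-- `V` is `ℂ³`. -/
abbrev V3 : Type := Fin 3 → ℂ

/-- The hermitian form of signature `(2,1)`:
`⟨x,y⟩ = x₀·conj y₀ + x₁·conj y₁ − x₂·conj y₂`. -/
def herm (x y : V3) : ℂ := x 0 * conj (y 0) + x 1 * conj (y 1) - x 2 * conj (y 2)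

/-- The complex projective plane `ℙ(V)`. -/
abbrev PV : Type := Projectivization ℂ V3

/-- The class `[v]` of a nonzero vector `v` in `ℙ(V)`. -/
def projMk (v : V3) (hv : v ≠ 0) : PV := Projectivization.mk ℂ v hv

/-- A map `h` is self-adjoint (`h* = h`) w.r.t. the hermitian form. -/
def SelfAdj (h : Module.End ℂ V3) : Prop := ∀ x y : V3, herm (h x) y = herm x (h y)

/-- The set `B_h = {[v] ∈ ℙ(V) | ⟨h v, v⟩ = 0}`. -/
def Bset (h : Module.End ℂ V3) : Set PV :=
  {q | ∃ v : V3, ∃ hv : v ≠ 0, q = projMk v hv ∧ herm (h v) v = 0}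

/-- `h` defines a bisector: self-adjoint, trace `0`, rank `2`, and `B_h` contains
a point other than the focus (i.e. a point `[v]` with `h v ≠ 0`). -/
def IsBisector (h : Module.End ℂ V3) : Prop :=
  SelfAdj h ∧ LinearMap.trace ℂ V3 h = 0 ∧
    Module.finrank ℂ (LinearMap.range h) = 2 ∧ ∃ v : V3, herm (h v) v = 0 ∧ h v ≠ 0

/-- A linear family of bisectors: an `ℝ`-subspace of self-adjoint traceless
degenerate maps whose base contains a negative point. -/
def IsLinearFamily (W : Submodule ℝ (Module.End ℂ V3)) : Prop :=
  (∀ h ∈ W, SelfAdj h ∧ LinearMap.trace ℂ V3 h = 0 ∧ LinearMap.det h = 0) ∧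
    ∃ v : V3, ∃ hv : v ≠ 0, (herm v v).re < 0 ∧ ∀ h ∈ W, herm (h v) v = 0

/-- The map `x ↦ ⟨x,p⟩·p`. -/
def wmap (p : V3) : Module.End ℂ V3 where
  toFun x := herm x p • p
  map_add' x y := by
    show herm (x + y) p • p = herm x p • p + herm y p • p
    have : herm (x + y) p = herm x p + herm y p := by
      simp only [herm, Pi.add_apply]; ring
    rw [this, add_smul]
  map_smul' c x := by
    show herm (c • x) p • p = c • (herm x p • p)
    have : herm (c • x) p = c * herm x p := by
      simp only [herm, Pi.smul_apply, smul_eq_mul]; ring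
    rw [this, mul_smul]

/-- `ℙ(U)` for a complex subspace `U`. -/
def projC (U : Submodule ℂ V3) : Set PV :=
  {q | ∃ v : V3, ∃ hv : v ≠ 0, v ∈ U ∧ q = projMk v hv}

/-- `ℙ(T)` for a real subspace `T`. -/
def projR (T : Submodule ℝ V3) : Set PV :=
  {q | ∃ v : V3, ∃ hv : v ≠ 0, v ∈ T ∧ q = projMk v hv}

/-- An `ℝ`-plane: `ℙ(T)` for a totally real `3`-dimensional real subspace `T`
with `ℂ·T = V`. -/
def IsRealPlane (T : Submodule ℝ V3) : Prop :=
  Module.finrank ℝ T = 3 ∧ Submodule.span ℂ (T : Set V3) = ⊤ ∧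
    ∀ t ∈ T, ∀ t' ∈ T, (herm t t').im = 0

/-- A geodesic: `ℙ(W₀)` for a `2`-dimensional real subspace `W₀` on which the form
is real-valued and not identically zero. -/
def IsGeodesic (W₀ : Submodule ℝ V3) : Prop :=
  Module.finrank ℝ W₀ = 2 ∧ (∀ w ∈ W₀, ∀ w' ∈ W₀, (herm w w').im = 0) ∧
    ∃ w ∈ W₀, ∃ w' ∈ W₀, herm w w' ≠ 0

/-- The real spine `R = {[h v] | [v] ∈ B_h, h v ≠ 0}` of `B_h`. -/
def RealSpine (h : Module.End ℂ V3) : Set PV :=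
  {q | ∃ v : V3, ∃ hnz : h v ≠ 0, herm (h v) v = 0 ∧ q = projMk (h v) hnz}

/-- The orthogonal complement w.r.t. the hermitian form. -/
def hermOrth (U : Submodule ℂ V3) : Submodule ℂ V3 where
  carrier := {x | ∀ u ∈ U, herm x u = 0}
  add_mem' := by
    intro a b ha hb u hu
    have h1 : herm (a + b) u = herm a u + herm b u := by
      simp only [herm, Pi.add_apply]; ring
    rw [h1, ha u hu, hb u hu, add_zero]
  zero_mem' := by
    intro u hu
    simp [herm]
  smul_mem' := by
    intro c x hx u hu
    have h1 : herm (c • x) u = c * herm x u := by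
      simp only [herm, Pi.smul_apply, smul_eq_mul]; ring
    rw [h1, hx u hu, mul_zero]


lemma herm_add_left (x y z : V3) : herm (x + y) z = herm x z + herm y z := by
  simp only [herm, Pi.add_apply]; ring

lemma herm_smul_left (c : ℂ) (x y : V3) : herm (c • x) y = c * herm x y := by
  simp only [herm, Pi.smul_apply, smul_eq_mul]; ring

lemma herm_add_right (x y z : V3) : herm x (y + z) = herm x y + herm x z := by
  simp only [herm, Pi.add_apply, map_add]; ring

lemma herm_smul_right (c : ℂ) (x y : V3) : herm x (c • y) = conj c * herm x y := by
  simp only [herm, Pi.smul_apply, smul_eq_mul, map_mul]; ring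

lemma herm_zero_left (x : V3) : herm 0 x = 0 := by simp [herm]

lemma herm_zero_right (x : V3) : herm x 0 = 0 := by simp [herm]

lemma conj_herm (x y : V3) : conj (herm x y) = herm y x := by
  simp only [herm, map_add, map_sub, map_mul, Complex.conj_conj]; ring

lemma SelfAdj.herm_conj {h : Module.End ℂ V3} (hs : SelfAdj h) (x y : V3) :
    herm (h y) x = conj (herm (h x) y) := by
  rw [conj_herm, hs]

lemma eq_zero_of_herm_eq_zero {x : V3} (hx : ∀ y, herm x y = 0) : x = 0 := by
  have h0 := hx (Pi.single 0 1)
  have h1 := hx (Pi.single 1 1)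
  have h2 := hx (Pi.single 2 1)
  simp [herm] at h0 h1 h2
  funext i
  fin_cases i <;> simp [*]

lemma exists_coords {e : Fin 3 → V3} (he : LinearIndependent ℂ e) (x : V3) :
    ∃ c : Fin 3 → ℂ, x = c 0 • e 0 + c 1 • e 1 + c 2 • e 2 := by
  let b := basisOfLinearIndependentOfCardEqFinrank he (by simp)
  refine ⟨b.repr x, ?_⟩
  conv_lhs => rw [← b.sum_repr x]
  simp [Fin.sum_univ_three, b]

lemma eq_zero_of_herm_basis {e : Fin 3 → V3} (he : LinearIndependent ℂ e) {x : V3}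
    (h0 : herm x (e 0) = 0) (h1 : herm x (e 1) = 0) (h2 : herm x (e 2) = 0) : x = 0 := by
  refine eq_zero_of_herm_eq_zero fun y => ?_
  obtain ⟨c, rfl⟩ := exists_coords he y
  simp [herm_add_right, herm_smul_right, h0, h1, h2]

/-- The Gram matrix of a degenerate map has zero determinant. -/
lemma det_gram_eq_zero {e : Fin 3 → V3} (he : LinearIndependent ℂ e) {h : Module.End ℂ V3}
    (hd : LinearMap.det h = 0) :
    (Matrix.of fun i j => herm (h (e j)) (e i)).det = 0 := by
  have hk : LinearMap.ker h ≠ ⊥ := fun hk => by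
    have := (LinearMap.isUnit_iff_ker_eq_bot h).2 hk
    exact (this.map LinearMap.det).ne_zero hd
  obtain ⟨k, hk, hk0⟩ := Submodule.exists_mem_ne_zero_of_ne_bot hk
  obtain ⟨c, rfl⟩ := exists_coords he k
  rw [← Matrix.exists_mulVec_eq_zero_iff]
  refine ⟨c, ?_, ?_⟩
  · rintro rfl
    simp at hk0
  · funext i
    have := congrArg (fun x => herm x (e i)) (LinearMap.mem_ker.1 hk)
    simp only [map_add, map_smul, herm_add_left, herm_smul_left, herm_zero_left] at this
    simp only [Matrix.mulVec, dotProduct, Fin.sum_univ_three, Matrix.of_apply, Pi.zero_apply]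
    linear_combination this

/-- A singular pencil of hermitian forms on `ℂ³` has a common kernel vector or a common
isotropic plane. -/
lemma common_kernel_or_isotropic {h₁ h₂ : Module.End ℂ V3} (hs₁ : SelfAdj h₁) (hs₂ : SelfAdj h₂)
    (hd₁ : LinearMap.det h₁ = 0) (hd₂ : LinearMap.det h₂ = 0)
    (hadd : LinearMap.det (h₁ + h₂) = 0) (hsub : LinearMap.det (h₁ - h₂) = 0) :
    (∃ k : V3, k ≠ 0 ∧ h₁ k = 0 ∧ h₂ k = 0) ∨
      ∃ x y : V3, LinearIndependent ℂ ![x, y] ∧ h₁ x = 0 ∧ h₂ y = 0 ∧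
        herm (h₁ y) y = 0 ∧ herm (h₂ x) x = 0 := by
  have key : ∀ h : Module.End ℂ V3, LinearMap.det h = 0 → ∃ x, x ≠ 0 ∧ h x = 0 := by
    intro h hd
    have hk : LinearMap.ker h ≠ ⊥ := fun hk => by
      have := (LinearMap.isUnit_iff_ker_eq_bot h).2 hk
      exact (this.map LinearMap.det).ne_zero hd
    obtain ⟨k, hk, hk0⟩ := Submodule.exists_mem_ne_zero_of_ne_bot hk
    exact ⟨k, hk0, hk⟩
  obtain ⟨x, hx0, hx⟩ := key h₁ hd₁
  obtain ⟨y, hy0, hy⟩ := key h₂ hd₂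
  by_cases hxy : LinearIndependent ℂ ![x, y]
  swap
  · left
    rw [LinearIndependent.pair_iff' hx0] at hxy
    push Not at hxy
    obtain ⟨a, rfl⟩ := hxy
    exact ⟨a • x, hy0, by simp [hx], hy⟩
  obtain ⟨z, hz⟩ := exists_linearIndependent_snoc_of_lt_finrank hxy
    (by simp : 2 < Module.finrank ℂ V3)
  set e : Fin 3 → V3 := Fin.snoc ![x, y] z with he
  have e0 : e 0 = x := rfl
  have e1 : e 1 = y := rfl
  have e2 : e 2 = z := rfl
  have hx' : ∀ w, herm (h₁ w) x = 0 := fun w => by rw [hs₁, hx, herm_zero_right]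
  have hy' : ∀ w, herm (h₂ w) y = 0 := fun w => by rw [hs₂, hy, herm_zero_right]
  have d1 := det_gram_eq_zero hz hadd
  have d2 := det_gram_eq_zero hz hsub
  have hneg : ∀ a b : V3, herm (a - b) = fun w => herm a w - herm b w := fun a b => by
    funext w; simp only [herm, Pi.sub_apply]; ring
  simp only [Matrix.det_fin_three, Matrix.of_apply, e0, e1, e2, LinearMap.add_apply,
    LinearMap.sub_apply, herm_add_left, hneg, hx, hy, hx', hy', herm_zero_left] at d1 d2
  have p1 : herm (h₂ x) x *
      (herm (h₁ y) y * herm (h₁ z) z - herm (h₁ z) y * herm (h₁ y) z) = 0 := by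
    linear_combination (d1 - d2) / 2
  have p2 : herm (h₁ y) y *
      (herm (h₂ x) x * herm (h₂ z) z - herm (h₂ z) x * herm (h₂ x) z) = 0 := by
    linear_combination (d1 + d2) / 2
  have czx : herm (h₂ z) x = conj (herm (h₂ x) z) := hs₂.herm_conj _ _
  have czy : herm (h₁ z) y = conj (herm (h₁ y) z) := hs₁.herm_conj _ _
  by_cases hp : herm (h₂ x) x = 0
  · by_cases ha : herm (h₁ y) y = 0
    · exact Or.inr ⟨x, y, hxy, hx, hy, ha, hp⟩
    · refine Or.inl ⟨x, hx0, hx, eq_zero_of_herm_basis hz hp (hy' x) ?_⟩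
      simpa [e2, hp, ha, czx] using p2
  · left
    by_cases ha : herm (h₁ y) y = 0
    · refine ⟨y, hy0, eq_zero_of_herm_basis hz (hx' y) ha ?_, hy⟩
      simpa [e2, hp, ha, czy] using p1
    · refine ⟨(-(herm (h₂ z) x) / herm (h₂ x) x) • x + (-(herm (h₁ z) y) / herm (h₁ y) y) • y + z,
        fun h0 => ?_, eq_zero_of_herm_basis hz (hx' _) ?_ ?_,
        eq_zero_of_herm_basis hz ?_ (hy' _) ?_⟩
      · have := Fintype.linearIndependent_iff.1 hz
          ![-(herm (h₂ z) x) / herm (h₂ x) x, -(herm (h₁ z) y) / herm (h₁ y) y, 1]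
          (by rw [Fin.sum_univ_three]; simpa [← he, e0, e1, e2] using h0) 2
        simp at this
      all_goals
        simp only [e0, e1, e2, map_add, map_smul, herm_add_left, herm_smul_left, hx, hy,
          herm_zero_left]
        field_simp
        first
          | ring1
          | linear_combination p1
          | linear_combination p2

/-- A spinor whose Bloch vector is orthogonal to two given vectors of `ℝ³`. -/
lemma exists_spinor (a₁ a₂ : ℝ) (b₁ b₂ : ℂ) : ∃ x y : ℂ, ¬(x = 0 ∧ y = 0) ∧
    a₁ * (Complex.normSq x - Complex.normSq y) + 2 * (x * conj y * b₁).re = 0 ∧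
    a₂ * (Complex.normSq x - Complex.normSq y) + 2 * (x * conj y * b₂).re = 0 := by
  obtain ⟨n, hn0, hn⟩ : ∃ n : Fin 3 → ℝ, n ≠ 0 ∧
      Matrix.mulVec !![a₁, b₁.re, b₁.im; a₂, b₂.re, b₂.im] n = 0 := by
    have := LinearMap.ker_ne_bot_of_finrank_lt
      (f := Matrix.mulVecLin !![a₁, b₁.re, b₁.im; a₂, b₂.re, b₂.im]) (by simp)
    obtain ⟨n, hn, hn0⟩ := Submodule.exists_mem_ne_zero_of_ne_bot this
    exact ⟨n, hn0, hn⟩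
  have n1 := congrFun hn 0
  have n2 := congrFun hn 1
  simp [Matrix.mulVec, dotProduct, Fin.sum_univ_three] at n1 n2
  set N := √(n 0 ^ 2 + n 1 ^ 2 + n 2 ^ 2) with hN
  have hN2 : N ^ 2 = n 0 ^ 2 + n 1 ^ 2 + n 2 ^ 2 := Real.sq_sqrt (by positivity)
  by_cases h : N + n 0 = 0
  · have hsum : n 1 ^ 2 + n 2 ^ 2 = 0 := by linear_combination (N - n 0) * h - hN2
    have h1 : n 1 = 0 := by nlinarith [sq_nonneg (n 1), sq_nonneg (n 2)]
    have h2 : n 2 = 0 := by nlinarith [sq_nonneg (n 1), sq_nonneg (n 2)]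
    have h0 : n 0 ≠ 0 := fun h0 => hn0 (by funext i; fin_cases i <;> simp [*])
    simp [h1, h2, h0] at n1 n2
    exact ⟨0, 1, by simp, by simp [n1], by simp [n2]⟩
  · refine ⟨⟨N + n 0, 0⟩, ⟨n 1, n 2⟩, fun h' => h (congrArg Complex.re h'.1), ?_, ?_⟩
    · simp [Complex.normSq_apply]
      linear_combination 2 * (N + n 0) * n1 + a₁ * hN2
    · simp [Complex.normSq_apply]
      linear_combination 2 * (N + n 0) * n2 + a₂ * hN2

lemma exists_orthonormal_complement {v : V3} (hv : (herm v v).re < 0) : ∃ e f : V3,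
    herm e e = 1 ∧ herm f f = 1 ∧ herm e f = 0 ∧ herm v e = 0 ∧ herm v f = 0 := by
  have hE : 0 < Complex.normSq (v 2) - Complex.normSq (v 1) := by
    have : (herm v v).re = Complex.normSq (v 0) + Complex.normSq (v 1) - Complex.normSq (v 2) := by
      simp [herm, Complex.normSq_apply]
    linarith [Complex.normSq_nonneg (v 0)]
  have hself : herm v v = ((herm v v).re : ℂ) := by
    rw [eq_comm, ← Complex.conj_eq_iff_re, conj_herm]
  set E := Complex.normSq (v 2) - Complex.normSq (v 1) with hEdef
  have hEc : (E : ℂ) = v 2 * conj (v 2) - v 1 * conj (v 1) := by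
    simp [hEdef, Complex.mul_conj]
  set F := -(herm v v).re with hF
  have hFpos : 0 < F := by linarith
  have hFc : (F : ℂ) = -herm v v := by rw [hF, Complex.ofReal_neg, ← hself]
  let e : V3 := ![0, conj (v 2), conj (v 1)]
  let f : V3 := ![-(E : ℂ), -(conj (v 0) * v 1), -(conj (v 0) * v 2)]
  have hee : herm e e = E := by simp [herm, e, hEc]; ring
  have hff : herm f f = (E * F : ℝ) := by
    rw [Complex.ofReal_mul, hFc]
    simp only [herm, f, hEc]
    simp
    ring
  have norm : ∀ (u : V3) (r : ℝ), 0 < r → herm u u = r →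
      herm (((√r)⁻¹ : ℂ) • u) (((√r)⁻¹ : ℂ) • u) = 1 := by
    intro u r hr hu
    have h1 : (√r : ℂ) * √r = r := by
      rw [← Complex.ofReal_mul, Real.mul_self_sqrt hr.le]
    have h2 : (√r : ℂ) ≠ 0 := by exact_mod_cast (Real.sqrt_pos.2 hr).ne'
    rw [herm_smul_left, herm_smul_right, hu, map_inv₀, Complex.conj_ofReal]
    field_simp
    rw [← h1]; ring
  refine ⟨_, _, norm e E hE hee, norm f (E * F) (by positivity) hff, ?_, ?_, ?_⟩ <;>
    simp only [herm_smul_left, herm_smul_right]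
  · have : herm e f = 0 := by simp [herm, e, f]; ring
    simp [this]
  · have : herm v e = 0 := by simp [herm, e]; ring
    simp [this]
  · have : herm v f = 0 := by simp [herm, f, hEc]; ring
    simp [this]

/-- The trace computed in an orthogonal basis with first vector in the kernel. -/
lemma herm_add_herm_eq_zero {v e f : V3} (hv : herm v v ≠ 0) (he : herm e e = 1)
    (hf : herm f f = 1) (hef : herm e f = 0) (hve : herm v e = 0) (hvf : herm v f = 0)
    {h : Module.End ℂ V3} (htr : LinearMap.trace ℂ V3 h = 0) (hhv : h v = 0) :
    herm (h e) e + herm (h f) f = 0 := by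
  have hev : herm e v = 0 := by rw [← conj_herm, hve, map_zero]
  have hfv : herm f v = 0 := by rw [← conj_herm, hvf, map_zero]
  have hfe : herm f e = 0 := by rw [← conj_herm, hef, map_zero]
  have hli : LinearIndependent ℂ ![v, e, f] := by
    rw [Fintype.linearIndependent_iff]
    intro g hg
    simp only [Fin.sum_univ_three] at hg
    have h0 := congrArg (fun x => herm x v) hg
    have h1 := congrArg (fun x => herm x e) hg
    have h2 := congrArg (fun x => herm x f) hg
    simp [herm_add_left, herm_smul_left, herm_zero_left, *] at h0 h1 h2
    intro i
    fin_cases i <;> assumption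
  let b := basisOfLinearIndependentOfCardEqFinrank hli (by simp)
  have hb : ∀ x, x = b.repr x 0 • v + b.repr x 1 • e + b.repr x 2 • f := fun x => by
    conv_lhs => rw [← b.sum_repr x]
    simp [Fin.sum_univ_three, b]
  have r1 : ∀ x, b.repr x 1 = herm x e := fun x => by
    conv_rhs => rw [hb x]
    simp [herm_add_left, herm_smul_left, hve, he, hfe]
  have r2 : ∀ x, b.repr x 2 = herm x f := fun x => by
    conv_rhs => rw [hb x]
    simp [herm_add_left, herm_smul_left, hvf, hef, hf]
  have b0 : b 0 = v := by simp [b]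
  have b1 : b 1 = e := by simp [b]
  have b2 : b 2 = f := by simp [b]
  rw [LinearMap.trace_eq_matrix_trace ℂ b, Matrix.trace_fin_three] at htr
  simpa [LinearMap.toMatrix_apply, b0, b1, b2, r1, r2, hhv] using htr

/-- Two traceless self-adjoint maps killing a negative vector have a common isotropic vector
independent of it. -/
lemma exists_isotropic_of_kernel {v : V3} (hv : (herm v v).re < 0) {h₁ h₂ : Module.End ℂ V3}
    (hs₁ : SelfAdj h₁) (hs₂ : SelfAdj h₂) (ht₁ : LinearMap.trace ℂ V3 h₁ = 0)
    (ht₂ : LinearMap.trace ℂ V3 h₂ = 0) (hv₁ : h₁ v = 0) (hv₂ : h₂ v = 0) :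
    ∃ w : V3, LinearIndependent ℂ ![v, w] ∧ herm (h₁ w) w = 0 ∧ herm (h₂ w) w = 0 := by
  have hvv : herm v v ≠ 0 := fun h => by simp [h] at hv
  obtain ⟨e, f, he, hf, hef, hve, hvf⟩ := exists_orthonormal_complement hv
  obtain ⟨x, y, hxy, hx₁, hx₂⟩ := exists_spinor (herm (h₁ e) e).re (herm (h₂ e) e).re
    (herm (h₁ e) f) (herm (h₂ e) f)
  have main : ∀ h : Module.End ℂ V3, SelfAdj h → LinearMap.trace ℂ V3 h = 0 → h v = 0 →
      (herm (h e) e).re * (Complex.normSq x - Complex.normSq y)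
        + 2 * (x * conj y * herm (h e) f).re = 0 →
      herm (h (x • e + y • f)) (x • e + y • f) = 0 := by
    intro h hs ht hhv hx
    have hsum := herm_add_herm_eq_zero hvv he hf hef hve hvf ht hhv
    have hre : ((herm (h e) e).re : ℂ) = herm (h e) e := by
      rw [← Complex.conj_eq_iff_re, ← hs.herm_conj]
    have hc : herm (h f) e = conj (herm (h e) f) := hs.herm_conj _ _
    have hx' := congrArg (fun r : ℝ => (r : ℂ)) hx
    simp only [Complex.ofReal_add, Complex.ofReal_mul, Complex.ofReal_sub, hre,
      Complex.ofReal_zero, Complex.ofReal_ofNat, Complex.normSq_eq_conj_mul_self,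
      Complex.re_eq_add_conj, map_mul, Complex.conj_conj] at hx'
    simp only [map_add, map_smul, herm_add_left, herm_add_right, herm_smul_left,
      herm_smul_right, hc]
    linear_combination hx' + y * conj y * hsum
  refine ⟨x • e + y • f, ?_, main h₁ hs₁ ht₁ hv₁ hx₁, main h₂ hs₂ ht₂ hv₂ hx₂⟩
  have hfe : herm f e = 0 := by rw [← conj_herm, hef, map_zero]
  rw [LinearIndependent.pair_iff]
  intro s t hst
  have h0 := congrArg (fun u => herm v u) hst
  have h1 := congrArg (fun u => herm u e) hst
  have h2 := congrArg (fun u => herm u f) hst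
  simp [herm_add_left, herm_smul_left, herm_zero_left, herm_add_right, herm_smul_right,
    herm_zero_right, hve, hvf, hvv, he, hf, hef, hfe] at h0 h1 h2
  tauto

/-- Corollary 4.5.3: any line of bisectors has a common slice. -/
theorem stmt_7 (W : Submodule ℝ (Module.End ℂ V3)) (hW : IsLinearFamily W)
    (hdim : Module.finrank ℝ W = 2) :
    ∃ U : Submodule ℂ V3, Module.finrank ℂ U = 2 ∧
      (∀ h ∈ W, ∀ u ∈ U, ∀ u' ∈ U, herm (h u) u' = 0) ∧
      ∀ h ∈ W, h ≠ 0 → projC U ⊆ Bset h := by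
  obtain ⟨hmem, v, hv0, hvneg, hvW⟩ := hW
  have : Module.Free ℝ W := Module.Free.of_divisionRing ℝ W
  have : Module.Finite ℝ W := Module.finite_of_finrank_pos (by omega)
  let b := Module.finBasisOfFinrankEq ℝ W hdim
  let h₁ : Module.End ℂ V3 := (b 0).1
  let h₂ : Module.End ℂ V3 := (b 1).1
  have m₁ : h₁ ∈ W := (b 0).2
  have m₂ : h₂ ∈ W := (b 1).2
  have hspan : ∀ h ∈ W, ∃ s t : ℝ, ∀ x, h x = (s : ℂ) • h₁ x + (t : ℂ) • h₂ x := by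
    intro h hh
    refine ⟨b.repr ⟨h, hh⟩ 0, b.repr ⟨h, hh⟩ 1, fun x => ?_⟩
    have := congrArg (fun g : W => (g : Module.End ℂ V3) x) (b.sum_repr ⟨h, hh⟩)
    simp only [Fin.sum_univ_two, Submodule.coe_add, Submodule.coe_smul] at this
    exact this.symm
  obtain ⟨s₁, t₁, d₁⟩ := hmem _ m₁
  obtain ⟨s₂, t₂, d₂⟩ := hmem _ m₂
  suffices H : ∃ x y : V3, LinearIndependent ℂ ![x, y] ∧
      herm (h₁ x) x = 0 ∧ herm (h₁ x) y = 0 ∧ herm (h₁ y) y = 0 ∧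
      herm (h₂ x) x = 0 ∧ herm (h₂ x) y = 0 ∧ herm (h₂ y) y = 0 by
    obtain ⟨x, y, hli, a1, a2, a3, c1, c2, c3⟩ := H
    have a4 : herm (h₁ y) x = 0 := by rw [s₁.herm_conj, a2, map_zero]
    have c4 : herm (h₂ y) x = 0 := by rw [s₂.herm_conj, c2, map_zero]
    have hU : ∀ h ∈ W, ∀ u ∈ Submodule.span ℂ (Set.range ![x, y]),
        ∀ u' ∈ Submodule.span ℂ (Set.range ![x, y]), herm (h u) u' = 0 := by
      intro h hh u hu u' hu'
      obtain ⟨s, t, hst⟩ := hspan h hh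
      simp only [Matrix.range_cons, Matrix.range_empty, Set.union_empty, Set.singleton_union,
        Submodule.mem_span_pair] at hu hu'
      obtain ⟨p, q, rfl⟩ := hu
      obtain ⟨p', q', rfl⟩ := hu'
      simp only [hst, map_add, map_smul, herm_add_left, herm_add_right, herm_smul_left,
        herm_smul_right, a1, a2, a3, a4, c1, c2, c3, c4, mul_zero, add_zero]
    refine ⟨Submodule.span ℂ (Set.range ![x, y]), by simp [finrank_span_eq_card hli], hU, ?_⟩
    rintro h hh - q ⟨u, hu0, hu, rfl⟩
    exact ⟨u, hu0, rfl, hU h hh u hu u hu⟩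
  rcases common_kernel_or_isotropic s₁ s₂ d₁ d₂ (hmem _ (W.add_mem m₁ m₂)).2.2
    (hmem _ (W.sub_mem m₁ m₂)).2.2 with ⟨k, hk0, k₁, k₂⟩ | ⟨x, y, hli, hx, hy, hy', hx'⟩
  · by_cases hli : LinearIndependent ℂ ![k, v]
    · exact ⟨k, v, hli, by simp [k₁, k₂, herm_zero_left, hvW, m₁, m₂]⟩
    · rw [LinearIndependent.pair_iff' hk0] at hli
      push Not at hli
      obtain ⟨c, rfl⟩ := hli
      have v₁ : h₁ (c • k) = 0 := by simp [k₁]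
      have v₂ : h₂ (c • k) = 0 := by simp [k₂]
      obtain ⟨w, hw, w₁, w₂⟩ := exists_isotropic_of_kernel hvneg s₁ s₂ t₁ t₂ v₁ v₂
      exact ⟨c • k, w, hw, by simp only [v₁, v₂, herm_zero_left, w₁, w₂, and_self]⟩
  · have : herm (h₂ x) y = 0 := by rw [s₂, hy, herm_zero_right]
    exact ⟨x, y, hli, by simp [hx, hy, herm_zero_left, hy', hx', this]⟩

end
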